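/- arXiv:0710.4991 — 2 statements merged into one kernel-verified Lean document; each statement's English description precedes it below -/
import Mathlib

section
/- The quadratic form x² + 2y² + 3z² over ℤ represents every positive integer except those of the form 2^d·u with d odd and u ≡ 5 (mod 8). -/
/-- A residue of `f` modulo `a` of absolute value at most `a / 2`. -/
theorem exists_two_mul_abs_sub_mul_le {a : ℤ} (ha : 0 < a) (f : ℤ) :
    ∃ k : ℤ, 4 * (f - k * a) ^ 2 ≤ a ^ 2 := by
  refine ⟨(2 * f + a) / (2 * a), ?_⟩
  have h₁ := Int.emod_add_mul_ediv (2 * f + a) (2 * a)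
  have h₂ := Int.emod_nonneg (2 * f + a) (show (2 * a) ≠ 0 by omega)
  have h₃ := Int.emod_lt_of_pos (2 * f + a) (show 0 < 2 * a by omega)
  set k := (2 * f + a) / (2 * a)
  set r := (2 * f + a) % (2 * a)
  have h₄ : 2 * (f - k * a) = r - a := by linear_combination -h₁
  nlinarith

/-- Every value of a positive definite integral ternary quadratic form of determinant one
is a sum of three squares. -/
theorem ternary_det_one_sum_three_squares (N : ℕ) :
    ∀ a b c d e f : ℤ, 0 < a → 0 < a * b - f ^ 2 →
      a * b * c + 2 * d * e * f - a * d ^ 2 - b * e ^ 2 - c * f ^ 2 = 1 →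
      a + (a * b - f ^ 2) ≤ N → ∀ x y z : ℤ, ∃ p q r : ℤ,
        a * x ^ 2 + b * y ^ 2 + c * z ^ 2 + 2 * d * y * z + 2 * e * x * z + 2 * f * x * y =
          p ^ 2 + q ^ 2 + r ^ 2 := by
  induction N with
  | zero =>
    intro a b c d e f ha hD _ hN
    push_cast at hN
    omega
  | succ N ih =>
    intro a b c d e f ha hD hdet hN x y z
    push_cast at hN
    by_cases h₁ : 4 * (a * b - f ^ 2) < 3 * a ^ 2
    · obtain ⟨k, hk⟩ := exists_two_mul_abs_sub_mul_le ha f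
      have hb : a * (b - 2 * k * f + k ^ 2 * a) = a * b - f ^ 2 + (f - k * a) ^ 2 := by ring
      have hpos : 0 < b - 2 * k * f + k ^ 2 * a := by
        refine pos_of_mul_pos_right (a := a) ?_ ha.le
        rw [hb]; positivity
      have hlt : b - 2 * k * f + k ^ 2 * a < a := by
        refine lt_of_mul_lt_mul_left (a := a) ?_ ha.le
        rw [hb]; linarith
      have hD' : (b - 2 * k * f + k ^ 2 * a) * a - (f - k * a) ^ 2 = a * b - f ^ 2 := by ring
      obtain ⟨p, q, r, h⟩ := ih (b - 2 * k * f + k ^ 2 * a) a c e (d - k * e) (f - k * a)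
        hpos (by rwa [hD']) (by linear_combination hdet) (by rw [hD']; linarith) y (x + k * y) z
      exact ⟨p, q, r, by rw [← h]; ring⟩
    by_cases h₂ : 4 * a < 3 * (a * b - f ^ 2) ^ 2
    · obtain ⟨k, hk⟩ := exists_two_mul_abs_sub_mul_le hD (a * d - e * f)
      set c' := c - 2 * k * d + k ^ 2 * b with hc'
      have hE : (a * b - f ^ 2) * (a * c' - (e - k * f) ^ 2) =
          a + (a * d - e * f - k * (a * b - f ^ 2)) ^ 2 := by
        rw [hc']; linear_combination a * hdet
      have hpos : 0 < a * c' - (e - k * f) ^ 2 := by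
        refine pos_of_mul_pos_right (a := a * b - f ^ 2) ?_ hD.le
        rw [hE]; positivity
      have hlt : a * c' - (e - k * f) ^ 2 < a * b - f ^ 2 := by
        refine lt_of_mul_lt_mul_left (a := a * b - f ^ 2) ?_ hD.le
        rw [hE]; linarith
      obtain ⟨p, q, r, h⟩ := ih a c' b (d - k * b) f (e - k * f)
        ha hpos (by rw [hc']; linear_combination hdet) (by linarith) x z (y + k * z)
      exact ⟨p, q, r, by rw [← h, hc']; ring⟩
    push Not at h₁ h₂
    set D := a * b - f ^ 2 with hDdef
    have haD : a = 1 ∧ D = 1 := by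
      constructor <;> nlinarith [sq_nonneg (a - 1), sq_nonneg (D - 1)]
    obtain ⟨rfl, hD1⟩ := haD
    rw [hD1] at hDdef
    refine ⟨x + f * y + e * z, y + (d - e * f) * z, z, ?_⟩
    have hb : b = 1 + f ^ 2 := by linarith
    subst hb
    linear_combination z ^ 2 * hdet

/-- A criterion for being a sum of three squares, from a form of determinant one. -/
theorem sum_three_squares_of_sq_add_dvd {m δ f b : ℤ} (hδ : 0 < δ) (hb : 0 < b)
    (hbm : b = δ * m - 1) (hf : b ∣ f ^ 2 + δ) : ∃ x y z : ℤ, x ^ 2 + y ^ 2 + z ^ 2 = m := by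
  obtain ⟨a, ha⟩ := hf
  have ha₀ : 0 < a := by
    refine pos_of_mul_pos_right (a := b) ?_ hb.le
    rw [← ha]; positivity
  have hD : a * b - f ^ 2 = δ := by linarith
  obtain ⟨p, q, r, h⟩ := ternary_det_one_sum_three_squares (a + δ).toNat a b m 0 1 f ha₀
    (by omega) (by linear_combination m * hD - hbm) (by rw [hD]; exact Int.self_le_toNat _) 0 0 1
  exact ⟨p, q, r, by linarith⟩

theorem sum_three_squares_of_mod_four_eq_two {m : ℕ} (hm : m % 4 = 2) :
    ∃ x y z : ℤ, x ^ 2 + y ^ 2 + z ^ 2 = m := by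
  have hcop : (m - 1).Coprime (4 * m) := by
    refine Nat.Coprime.mul_right ?_ ?_
    · exact Nat.Coprime.pow_right 2 (Nat.coprime_two_right.2 (Nat.odd_iff.2 (by omega)))
    · exact (Nat.coprime_self_sub_left (by omega)).2 (Nat.coprime_one_left m)
  obtain ⟨p, hpgt, hp, hmod⟩ := Nat.forall_exists_prime_gt_and_modEq (m - 1) (by omega) hcop
  obtain ⟨j, hj⟩ := (Nat.modEq_iff_dvd' hpgt.le).1 hmod.symm
  have hpj : p + 1 = (4 * j + 1) * m := by
    have : p = 4 * m * j + (m - 1) := by omega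
    rw [this, add_assoc, Nat.sub_add_cancel (by omega)]; ring
  have hp4 : p % 4 = 1 := by
    rw [mul_assoc] at hj
    omega
  have : Fact p.Prime := ⟨hp⟩
  have hodd : Odd p := Nat.odd_iff.2 (by omega)
  have hδ : Odd (4 * j + 1) := Nat.odd_iff.2 (by omega)
  have hJ : jacobiSym (-((4 * j + 1 : ℕ) : ℤ)) p = 1 := by
    rw [jacobiSym.neg _ hodd, ZMod.χ₄_nat_one_mod_four hp4, one_mul,
      jacobiSym.quadratic_reciprocity_one_mod_four' hδ hp4,
      jacobiSym.mod_left' (a₂ := -1), jacobiSym.at_neg_one hδ,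
      ZMod.χ₄_nat_one_mod_four (by omega)]
    refine Int.ModEq.symm ((Int.modEq_iff_dvd).2 ⟨m, ?_⟩)
    have : (p : ℤ) + 1 = ((4 * j + 1 : ℕ) : ℤ) * m := by exact_mod_cast hpj
    linarith
  obtain ⟨s, hs⟩ := ZMod.isSquare_of_jacobiSym_eq_one hJ
  have hdvd : (p : ℤ) ∣ (s.val : ℤ) ^ 2 + ((4 * j + 1 : ℕ) : ℤ) := by
    rw [← ZMod.intCast_zmod_eq_zero_iff_dvd]
    push_cast at hs ⊢
    rw [ZMod.natCast_zmod_val]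
    linear_combination -hs
  refine sum_three_squares_of_sq_add_dvd (δ := ((4 * j + 1 : ℕ) : ℤ)) (by positivity)
    (by exact_mod_cast hp.pos) ?_ hdvd
  have : (p : ℤ) + 1 = ((4 * j + 1 : ℕ) : ℤ) * m := by exact_mod_cast hpj
  linarith

/-- The criterion behind the odd case: `2 * p + 1 = δ * m` with `-δ` a square modulo `p`. -/
theorem sum_three_squares_of_jacobiSym {m p δ : ℕ} [hp : Fact p.Prime] (hp2 : Odd p) (hδ : Odd δ)
    (h : 2 * p + 1 = δ * m) (hJ : jacobiSym (-(δ : ℤ)) p = 1) :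
    ∃ x y z : ℤ, x ^ 2 + y ^ 2 + z ^ 2 = m := by
  obtain ⟨s, hs⟩ := ZMod.isSquare_of_jacobiSym_eq_one hJ
  have key : ∀ t : ℤ, (t : ZMod p) = s → Odd t → ((2 * p : ℕ) : ℤ) ∣ t ^ 2 + δ := by
    intro t ht hto
    have h1 : (p : ℤ) ∣ t ^ 2 + δ := by
      rw [← ZMod.intCast_zmod_eq_zero_iff_dvd]
      push_cast at hs ⊢
      rw [ht]
      linear_combination -hs
    have h2 : (2 : ℤ) ∣ t ^ 2 + δ :=
      even_iff_two_dvd.1 (hto.pow.add_odd (by exact_mod_cast hδ))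
    push_cast
    refine IsCoprime.mul_dvd ?_ h2 h1
    exact_mod_cast (Nat.isCoprime_iff_coprime.2 (Nat.coprime_two_left.2 hp2))
  obtain ⟨t, ht⟩ : ∃ t : ℤ, ((2 * p : ℕ) : ℤ) ∣ t ^ 2 + δ := by
    rcases Int.even_or_odd (s.val : ℤ) with he | ho
    · exact ⟨s.val + p, key _ (by simp) (he.add_odd (by exact_mod_cast hp2))⟩
    · exact ⟨s.val, key _ (by simp) ho⟩
  refine sum_three_squares_of_sq_add_dvd (δ := δ) (by exact_mod_cast hδ.pos)
    (by exact_mod_cast Nat.mul_pos two_pos hp.out.pos) ?_ ht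
  have : 2 * (p : ℤ) + 1 = δ * m := by exact_mod_cast h
  push_cast
  linarith

theorem exists_prime_two_mul_add_one_eq {m c r : ℕ} (hm : Odd m) (hr : Odd r)
    (h : 2 * r + 1 = c * m) :
    ∃ p j : ℕ, p.Prime ∧ p % 4 = r % 4 ∧ 2 * p + 1 = (8 * j + c) * m := by
  have hcop : r.Coprime (4 * m) := by
    refine Nat.Coprime.mul_right ?_ ?_
    · exact Nat.Coprime.pow_right 2 (Nat.coprime_two_right.2 hr)
    · have : IsCoprime (r : ℤ) m := ⟨-2, c, by
        have : 2 * (r : ℤ) + 1 = c * m := by exact_mod_cast h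
        linarith⟩
      exact Nat.isCoprime_iff_coprime.1 this
  obtain ⟨p, hpgt, hp, hmod⟩ :=
    Nat.forall_exists_prime_gt_and_modEq r (by have := hm.pos; omega) hcop
  obtain ⟨j, hj⟩ := (Nat.modEq_iff_dvd' hpgt.le).1 hmod.symm
  have hpj : p = 4 * (m * j) + r := by
    rw [mul_assoc] at hj
    omega
  exact ⟨p, j, hp, by omega, by linear_combination 2 * hpj + h⟩

theorem sum_three_squares_of_odd {m : ℕ} (hm : m % 8 = 1 ∨ m % 8 = 3 ∨ m % 8 = 5) :
    ∃ x y z : ℤ, x ^ 2 + y ^ 2 + z ^ 2 = m := by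
  have hmo : Odd m := Nat.odd_iff.2 (by omega)
  have reduce : ∀ {p δ : ℕ}, Odd δ → 2 * p + 1 = δ * m →
      jacobiSym 2 δ * jacobiSym p δ = ZMod.χ₄ δ := by
    intro p δ hδ h
    rw [← jacobiSym.mul_left, ← jacobiSym.at_neg_one hδ]
    refine jacobiSym.mod_left' (Int.ModEq.symm ((Int.modEq_iff_dvd).2 ⟨m, ?_⟩))
    have : 2 * (p : ℤ) + 1 = δ * m := by exact_mod_cast h
    linarith
  rcases hm with hm | hm | hm
  · obtain ⟨p, j, hp, hp4, h⟩ := exists_prime_two_mul_add_one_eq (c := 3) (r := (3 * m - 1) / 2)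
      hmo (Nat.odd_iff.2 (by omega)) (by omega)
    have hp4 : p % 4 = 1 := by omega
    have hδ : Odd (8 * j + 3) := Nat.odd_iff.2 (by omega)
    have hodd : Odd p := Nat.odd_iff.2 (by omega)
    have : Fact p.Prime := ⟨hp⟩
    refine sum_three_squares_of_jacobiSym hodd hδ h ?_
    have hr := reduce hδ h
    rw [jacobiSym.at_two hδ, ZMod.χ₈_nat_eq_if_mod_eight, ZMod.χ₄_nat_three_mod_four (by omega),
      if_neg (by omega), if_neg (by omega)] at hr
    rw [jacobiSym.neg _ hodd, ZMod.χ₄_nat_one_mod_four hp4,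
      jacobiSym.quadratic_reciprocity_one_mod_four' hδ hp4]
    linarith
  · obtain ⟨p, j, hp, hp4, h⟩ := exists_prime_two_mul_add_one_eq (c := 1) (r := (m - 1) / 2)
      hmo (Nat.odd_iff.2 (by omega)) (by omega)
    have hp4 : p % 4 = 1 := by omega
    have hδ : Odd (8 * j + 1) := Nat.odd_iff.2 (by omega)
    have hodd : Odd p := Nat.odd_iff.2 (by omega)
    have : Fact p.Prime := ⟨hp⟩
    refine sum_three_squares_of_jacobiSym hodd hδ h ?_
    have hr := reduce hδ h
    rw [jacobiSym.at_two hδ, ZMod.χ₈_nat_eq_if_mod_eight, ZMod.χ₄_nat_one_mod_four (by omega),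
      if_neg (by omega), if_pos (by omega)] at hr
    rw [jacobiSym.neg _ hodd, ZMod.χ₄_nat_one_mod_four hp4,
      jacobiSym.quadratic_reciprocity_one_mod_four' hδ hp4]
    linarith
  · obtain ⟨p, j, hp, hp4, h⟩ := exists_prime_two_mul_add_one_eq (c := 3) (r := (3 * m - 1) / 2)
      hmo (Nat.odd_iff.2 (by omega)) (by omega)
    have hp4 : p % 4 = 3 := by omega
    have hδ : Odd (8 * j + 3) := Nat.odd_iff.2 (by omega)
    have hodd : Odd p := Nat.odd_iff.2 (by omega)
    have : Fact p.Prime := ⟨hp⟩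
    refine sum_three_squares_of_jacobiSym hodd hδ h ?_
    have hr := reduce hδ h
    rw [jacobiSym.at_two hδ, ZMod.χ₈_nat_eq_if_mod_eight, ZMod.χ₄_nat_three_mod_four (by omega),
      if_neg (by omega), if_neg (by omega)] at hr
    rw [jacobiSym.neg _ hodd, ZMod.χ₄_nat_three_mod_four hp4,
      jacobiSym.quadratic_reciprocity_three_mod_four (by omega) hp4]
    linarith

/-- If `6 * n` is a sum of three squares, then `x ^ 2 + 2 * y ^ 2 + 3 * z ^ 2` represents `n`. -/
theorem exists_of_six_mul_eq_sum_three_squares {n a b c : ℤ}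
    (h : a ^ 2 + b ^ 2 + c ^ 2 = 6 * n) :
    ∃ x y z : ℤ, x ^ 2 + 2 * y ^ 2 + 3 * z ^ 2 = n := by
  have of_congr : ∀ {a b c : ℤ}, a ^ 2 + b ^ 2 + c ^ 2 = 6 * n →
      (a - b) % 3 = 0 → (b - c) % 3 = 0 → (a - b) % 2 = 0 → c % 2 = 0 →
      ∃ x y z : ℤ, x ^ 2 + 2 * y ^ 2 + 3 * z ^ 2 = n := by
    intro a b c h h₁ h₂ h₃ h₄
    obtain ⟨x, hx⟩ : ∃ x, a + b - 2 * c = 6 * x := ⟨(a + b - 2 * c) / 6, by omega⟩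
    obtain ⟨y, hy⟩ : ∃ y, a + b + c = 6 * y := ⟨(a + b + c) / 6, by omega⟩
    obtain ⟨z, hz⟩ : ∃ z, a - b = 6 * z := ⟨(a - b) / 6, by omega⟩
    refine ⟨x, y, z, ?_⟩
    have h36 : (6 * x) ^ 2 + 2 * (6 * y) ^ 2 + 3 * (6 * z) ^ 2 = 36 * n := by
      rw [← hx, ← hy, ← hz]; linear_combination 6 * h
    linarith
  have sign : ∀ b : ℤ, a % 3 = 0 ∧ b % 3 = 0 ∨ a % 3 ≠ 0 ∧ b % 3 ≠ 0 →
      ∃ b' : ℤ, b' ^ 2 = b ^ 2 ∧ (a - b') % 3 = 0 ∧ b' % 2 = b % 2 := by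
    intro b hb
    by_cases hab : (a - b) % 3 = 0
    · exact ⟨b, rfl, hab, rfl⟩
    · have ha : a % 3 = 0 ∨ a % 3 = 1 ∨ a % 3 = 2 := by omega
      have hb : b % 3 = 0 ∨ b % 3 = 1 ∨ b % 3 = 2 := by omega
      refine ⟨-b, by ring, ?_, by omega⟩
      rcases ha with ha | ha | ha <;> rcases hb with hb | hb | hb <;> omega
  have sq3 : ∀ t : ℤ, t % 3 = 0 ∧ t ^ 2 % 3 = 0 ∨ t % 3 ≠ 0 ∧ t ^ 2 % 3 = 1 := by
    intro t
    have : t % 3 = 0 ∨ t % 3 = 1 ∨ t % 3 = 2 := by omega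
    rcases this with ht | ht | ht <;> simp [pow_two, Int.mul_emod, ht]
  have sq2 : ∀ t : ℤ, t ^ 2 % 2 = t % 2 := by
    intro t
    rcases Int.emod_two_eq_zero_or_one t with ht | ht <;> simp [pow_two, Int.mul_emod, ht]
  have ha := sq3 a
  have hb := sq3 b
  have hc := sq3 c
  obtain ⟨b', hb2, hb3, hbp⟩ := sign b (by omega)
  obtain ⟨c', hc2, hc3, hcp⟩ := sign c (by omega)
  have h' : a ^ 2 + b' ^ 2 + c' ^ 2 = 6 * n := by rw [hb2, hc2, h]
  clear ha hb hc
  have ha' := sq2 a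
  have hb' := sq2 b'
  have hc' := sq2 c'
  have : a % 2 = 0 ∧ (b' - c') % 2 = 0 ∨ b' % 2 = 0 ∧ (a - c') % 2 = 0 ∨
      c' % 2 = 0 ∧ (a - b') % 2 = 0 := by
    have hsum : (a + b' + c') % 2 = 0 := by omega
    clear ha' hb' hc'
    rcases Int.emod_two_eq_zero_or_one a with h₁ | h₁ <;>
      rcases Int.emod_two_eq_zero_or_one b' with h₂ | h₂ <;> omega
  rcases this with ⟨h₁, h₂⟩ | ⟨h₁, h₂⟩ | ⟨h₁, h₂⟩
  · exact of_congr (a := b') (b := c') (c := a) (by linarith) (by omega) (by omega) h₂ h₁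
  · exact of_congr (a := a) (b := c') (c := b') (by linarith) (by omega) (by omega) h₂ h₁
  · exact of_congr (a := a) (b := b') (c := c') (by linarith) (by omega) (by omega) h₂ h₁

theorem ne_two_mul_of_mod_eight_eq_five {u : ℕ} (hu : u % 8 = 5) (x y z : ℤ) :
    x ^ 2 + 2 * y ^ 2 + 3 * z ^ 2 ≠ 2 * u := by
  intro h
  have sq16 : ∀ t : ℤ, t ^ 2 % 16 = 0 ∨ t ^ 2 % 16 = 1 ∨ t ^ 2 % 16 = 4 ∨ t ^ 2 % 16 = 9 := by
    intro t
    have h₀ := Int.emod_nonneg t (show (16 : ℤ) ≠ 0 by norm_num)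
    have h₁ := Int.emod_lt_of_pos t (show (0 : ℤ) < 16 by norm_num)
    rw [pow_two, Int.mul_emod]
    generalize t % 16 = r at *
    interval_cases r <;> decide
  have hx := sq16 x
  have hy := sq16 y
  have hz := sq16 z
  omega

theorem even_of_eight_dvd {x y z : ℤ} (h : (8 : ℤ) ∣ x ^ 2 + 2 * y ^ 2 + 3 * z ^ 2) :
    Even x ∧ Even y ∧ Even z := by
  have sq8 : ∀ t : ℤ, t ^ 2 % 8 = 1 ∨ t % 2 = 0 ∧ t ^ 2 % 4 = 0 := by
    intro t
    rcases Int.even_or_odd' t with ⟨k, rfl | rfl⟩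
    · exact Or.inr ⟨by omega, by ring_nf; omega⟩
    · have := Int.eight_dvd_sq_sub_one_of_odd (k := 2 * k + 1) ⟨k, rfl⟩
      exact Or.inl (by omega)
  have hx := sq8 x
  have hy := sq8 y
  have hz := sq8 z
  simp only [Int.even_iff]
  omega

theorem ne_two_pow_mul_of_mod_eight_eq_five {u : ℕ} (hu : u % 8 = 5) (k : ℕ) :
    ∀ x y z : ℤ, x ^ 2 + 2 * y ^ 2 + 3 * z ^ 2 ≠ 2 ^ (2 * k + 1) * u := by
  induction k with
  | zero => simpa using ne_two_mul_of_mod_eight_eq_five hu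
  | succ k ih =>
    intro x y z h
    have h' : x ^ 2 + 2 * y ^ 2 + 3 * z ^ 2 = 4 * (2 ^ (2 * k + 1) * u) := by rw [h]; ring
    obtain ⟨⟨x, rfl⟩, ⟨y, rfl⟩, ⟨z, rfl⟩⟩ :=
      even_of_eight_dvd (x := x) (y := y) (z := z) ⟨2 ^ (2 * k) * u, by rw [h]; ring⟩
    exact ih x y z (by linarith)

theorem exists_four_pow_mul_of_exists {m : ℤ}
    (h : ∃ x y z : ℤ, x ^ 2 + y ^ 2 + z ^ 2 = m) (k : ℕ) :
    ∃ x y z : ℤ, x ^ 2 + y ^ 2 + z ^ 2 = 2 ^ (2 * k) * m := by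
  obtain ⟨x, y, z, rfl⟩ := h
  exact ⟨2 ^ k * x, 2 ^ k * y, 2 ^ k * z, by ring⟩

theorem stmt_6 (n : ℕ) (hn : 0 < n) :
    (¬ ∃ x y z : ℤ, x ^ 2 + 2 * y ^ 2 + 3 * z ^ 2 = (n : ℤ)) ↔
      ∃ d u : ℕ, Odd d ∧ u % 8 = 5 ∧ n = 2 ^ d * u := by
  constructor
  · intro h
    obtain ⟨d, u, hu, rfl⟩ := Nat.exists_eq_two_pow_mul_odd hn.ne'
    have hu2 := Nat.odd_iff.1 hu
    by_contra hne
    apply h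
    suffices ∃ x y z : ℤ, x ^ 2 + y ^ 2 + z ^ 2 = 6 * ((2 ^ d * u : ℕ) : ℤ) by
      obtain ⟨x, y, z, hxyz⟩ := this
      exact exists_of_six_mul_eq_sum_three_squares hxyz
    rcases Nat.even_or_odd' d with ⟨k, rfl | rfl⟩
    · obtain ⟨x, y, z, hxyz⟩ := exists_four_pow_mul_of_exists
        (sum_three_squares_of_mod_four_eq_two (m := 6 * u) (by omega)) k
      exact ⟨x, y, z, by rw [hxyz]; push_cast; ring⟩
    · have hu5 : u % 8 ≠ 5 := fun hu5 => hne ⟨2 * k + 1, u, ⟨k, rfl⟩, hu5, rfl⟩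
      obtain ⟨x, y, z, hxyz⟩ := exists_four_pow_mul_of_exists
        (sum_three_squares_of_odd (m := 3 * u) (by omega)) (k + 1)
      exact ⟨x, y, z, by rw [hxyz]; push_cast; ring⟩
  · rintro ⟨d, u, ⟨k, rfl⟩, hu, rfl⟩ ⟨x, y, z, h⟩
    exact ne_two_pow_mul_of_mod_eight_eq_five hu k x y z (by rw [h]; push_cast; ring)
end

section
/- The quadratic form x² + y² + 3z² over ℤ represents every positive integer except exactly the integers of the form 3^d·u with d odd and u a quadratic nonresidue modulo 3 (i.e. u ≡ 2 mod 3). -/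
/-- The ternary form with Gram matrix `[[a, f, e], [f, b, d], [e, d, c]]` is obtained by an integral
linear substitution from `X² + Y² + 3Z²` or from `X² + 2(Y² + YZ + Z²)`. -/
def IsPulledBack (a b c d e f : ℤ) : Prop :=
  ∃ u₁ u₂ u₃ v₁ v₂ v₃ w₁ w₂ w₃ : ℤ,
    (∀ x y z : ℤ, a * x ^ 2 + b * y ^ 2 + c * z ^ 2 + 2 * d * y * z + 2 * e * x * z + 2 * f * x * y =
      (u₁ * x + u₂ * y + u₃ * z) ^ 2 + (v₁ * x + v₂ * y + v₃ * z) ^ 2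
        + 3 * (w₁ * x + w₂ * y + w₃ * z) ^ 2) ∨
    (∀ x y z : ℤ, a * x ^ 2 + b * y ^ 2 + c * z ^ 2 + 2 * d * y * z + 2 * e * x * z + 2 * f * x * y =
      (u₁ * x + u₂ * y + u₃ * z) ^ 2 + 2 * ((v₁ * x + v₂ * y + v₃ * z) ^ 2
        + (v₁ * x + v₂ * y + v₃ * z) * (w₁ * x + w₂ * y + w₃ * z)
        + (w₁ * x + w₂ * y + w₃ * z) ^ 2))

namespace IsPulledBack

variable {a b c d e f : ℤ}

theorem of_swap_fst_snd (h : IsPulledBack b a c e d f) : IsPulledBack a b c d e f := by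
  obtain ⟨u₁, u₂, u₃, v₁, v₂, v₃, w₁, w₂, w₃, h⟩ := h
  refine ⟨u₂, u₁, u₃, v₂, v₁, v₃, w₂, w₁, w₃, ?_⟩
  rcases h with h | h
  · exact Or.inl fun x y z => by linear_combination h y x z
  · exact Or.inr fun x y z => by linear_combination h y x z

theorem of_swap_snd_trd (h : IsPulledBack a c b d f e) : IsPulledBack a b c d e f := by
  obtain ⟨u₁, u₂, u₃, v₁, v₂, v₃, w₁, w₂, w₃, h⟩ := h
  refine ⟨u₁, u₃, u₂, v₁, v₃, v₂, w₁, w₃, w₂, ?_⟩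
  rcases h with h | h
  · exact Or.inl fun x y z => by linear_combination h x z y
  · exact Or.inr fun x y z => by linear_combination h x z y

theorem of_shift_trd_snd (k : ℤ)
    (h : IsPulledBack a b (c + 2 * k * d + k ^ 2 * b) (d + k * b) (e + k * f) f) :
    IsPulledBack a b c d e f := by
  obtain ⟨u₁, u₂, u₃, v₁, v₂, v₃, w₁, w₂, w₃, h⟩ := h
  refine ⟨u₁, u₂, u₃ - k * u₂, v₁, v₂, v₃ - k * v₂, w₁, w₂, w₃ - k * w₂, ?_⟩
  rcases h with h | h
  · exact Or.inl fun x y z => by linear_combination h x (y - k * z) z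
  · exact Or.inr fun x y z => by linear_combination h x (y - k * z) z

theorem of_shift_snd_fst (k : ℤ)
    (h : IsPulledBack a (b + 2 * k * f + k ^ 2 * a) c (d + k * e) e (f + k * a)) :
    IsPulledBack a b c d e f := by
  obtain ⟨u₁, u₂, u₃, v₁, v₂, v₃, w₁, w₂, w₃, h⟩ := h
  refine ⟨u₁, u₂ - k * u₁, u₃, v₁, v₂ - k * v₁, v₃, w₁, w₂ - k * w₁, w₃, ?_⟩
  rcases h with h | h
  · exact Or.inl fun x y z => by linear_combination h (x - k * y) y z
  · exact Or.inr fun x y z => by linear_combination h (x - k * y) y z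

theorem of_shift_trd_fst (k : ℤ)
    (h : IsPulledBack a b (c + 2 * k * e + k ^ 2 * a) (d + k * f) (e + k * a) f) :
    IsPulledBack a b c d e f :=
  of_swap_snd_trd (of_shift_snd_fst k (of_swap_snd_trd h))

/-- Hermite reduction: a form that cannot be shortened further is explicitly known. -/
theorem of_reduced (ha : 0 < a) (hg : 0 < a * b - f ^ 2)
    (hdet : a * b * c + 2 * d * e * f - a * d ^ 2 - b * e ^ 2 - c * f ^ 2 = 3)
    (hf : |2 * f| ≤ a) (he : |2 * e| ≤ a) (hh : |2 * (a * d - f * e)| ≤ a * b - f ^ 2)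
    (hab : a ≤ b) (hgk : a * b - f ^ 2 ≤ a * c - e ^ 2) : IsPulledBack a b c d e f := by
  have hf2 : 4 * f ^ 2 ≤ a ^ 2 := by
    have := sq_le_sq' (abs_le.mp hf).1 (abs_le.mp hf).2
    linarith
  set g := a * b - f ^ 2 with hgdef
  set k := a * c - e ^ 2 with hkdef
  set h := a * d - f * e with hhdef
  have hh2 : 4 * h ^ 2 ≤ g ^ 2 := by
    have := sq_le_sq' (abs_le.mp hh).1 (abs_le.mp hh).2
    linarith
  have hdet2 : g * k - h ^ 2 = 3 * a := by
    rw [hgdef, hkdef, hhdef]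
    linear_combination a * hdet
  have hg2 : g ^ 2 ≤ 4 * a := by nlinarith
  have hag : 3 * a ^ 2 ≤ 4 * g := by nlinarith
  have ha1 : a = 1 := by
    by_contra hne
    have h2 : 2 ≤ a := by omega
    have h3 : 3 * a ≤ 2 * g := by nlinarith
    have h4 : g ≤ 2 := by nlinarith
    nlinarith
  subst ha1
  have hf0 : f = 0 := by rw [abs_le] at hf; omega
  have he0 : e = 0 := by rw [abs_le] at he; omega
  subst hf0 he0
  have hgb : g = b := by rw [hgdef]; ring
  have hhd : h = d := by rw [hhdef]; ring
  have hkc : k = c := by rw [hkdef]; ring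
  rw [hgb, hhd, hkc] at hdet2
  rw [hhd, hgb, abs_le] at hh
  rw [hgb] at hg2 hg
  have hb2 : b ≤ 2 := by nlinarith
  obtain rfl | rfl : b = 1 ∨ b = 2 := by omega
  · obtain rfl : d = 0 := by omega
    obtain rfl : c = 3 := by linarith
    exact ⟨1, 0, 0, 0, 1, 0, 0, 0, 1, Or.inl fun x y z => by ring⟩
  · obtain rfl | rfl | rfl : d = 0 ∨ d = 1 ∨ d = -1 := by omega
    · omega
    · obtain rfl : c = 2 := by linarith
      exact ⟨1, 0, 0, 0, 1, 0, 0, 0, 1, Or.inr fun x y z => by ring⟩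
    · obtain rfl : c = 2 := by linarith
      exact ⟨1, 0, 0, 0, 1, 0, 0, 0, -1, Or.inr fun x y z => by ring⟩

end IsPulledBack

theorem exists_abs_two_mul_add_mul_le {a : ℤ} (ha : 0 < a) (f : ℤ) :
    ∃ k : ℤ, |2 * (f + k * a)| ≤ a := by
  refine ⟨-((2 * f + a) / (2 * a)), ?_⟩
  have h1 := Int.emod_add_mul_ediv (2 * f + a) (2 * a)
  have h2 := Int.emod_nonneg (2 * f + a) (b := 2 * a) (by omega)
  have h3 := Int.emod_lt_of_pos (2 * f + a) (b := 2 * a) (by omega)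
  rw [abs_le]
  constructor <;> nlinarith

/-- Every positive definite integral ternary form of determinant `3` is pulled back from one of the
two reduced forms. -/
theorem IsPulledBack.of_det_eq_three (A G : ℕ) : ∀ a b c d e f : ℤ, a.toNat = A →
    (a * b - f ^ 2).toNat = G → 0 < a → 0 < a * b - f ^ 2 →
    a * b * c + 2 * d * e * f - a * d ^ 2 - b * e ^ 2 - c * f ^ 2 = 3 →
    IsPulledBack a b c d e f := by
  induction A using Nat.strong_induction_on generalizing G with
  | _ A ihA =>
  induction G using Nat.strong_induction_on with
  | _ G ihG =>
  have normalized : ∀ a b c d e f : ℤ, a.toNat = A →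
      (a * b - f ^ 2).toNat = G → 0 < a → 0 < a * b - f ^ 2 →
      a * b * c + 2 * d * e * f - a * d ^ 2 - b * e ^ 2 - c * f ^ 2 = 3 →
      |2 * f| ≤ a → |2 * e| ≤ a → |2 * (a * d - f * e)| ≤ a * b - f ^ 2 →
      IsPulledBack a b c d e f := by
    intro a b c d e f hA hG ha hg hdet hf he hh
    by_cases hab : a ≤ b
    · by_cases hgk : a * b - f ^ 2 ≤ a * c - e ^ 2
      · exact .of_reduced ha hg hdet hf he hh hab hgk
      · have hk : 0 < a * c - e ^ 2 := by
          have : (a * b - f ^ 2) * (a * c - e ^ 2) = 3 * a + (a * d - f * e) ^ 2 := by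
            linear_combination a * hdet
          exact pos_of_mul_pos_right (by rw [this]; positivity) hg.le
        exact .of_swap_snd_trd (ihG (a * c - e ^ 2).toNat (by omega) _ _ _ _ _ _ hA rfl ha hk
          (by linear_combination hdet))
    · have hb : 0 < b := by
        refine pos_of_mul_pos_right (a := a) ?_ ha.le
        nlinarith [sq_nonneg f]
      exact .of_swap_fst_snd (ihA b.toNat (by omega) _ _ _ _ _ _ _ rfl rfl hb
        (by linarith) (by linear_combination hdet))
  intro a b c d e f hA hG ha hg hdet
  obtain ⟨m, hm⟩ := exists_abs_two_mul_add_mul_le hg (a * d - f * e)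
  obtain ⟨k, hk⟩ := exists_abs_two_mul_add_mul_le ha f
  obtain ⟨l, hl⟩ := exists_abs_two_mul_add_mul_le ha (e + m * f)
  refine .of_shift_trd_snd m (.of_shift_snd_fst k (.of_shift_trd_fst l ?_))
  have hminor : a * (b + 2 * k * f + k ^ 2 * a) - (f + k * a) ^ 2 = a * b - f ^ 2 := by ring
  refine normalized _ _ _ _ _ _ hA (by rw [hminor, hG]) ha (by rwa [hminor])
    (by linear_combination hdet) hk hl ?_
  rw [hminor]
  convert hm using 3
  ring

theorem exists_sq_add_sq_add_three_mul_sq {n p D β t : ℤ} (hp : 0 < p) (hD : 0 < D)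
    (hD3 : D % 3 = 1) (hβ : p ∣ β ^ 2 + D) (h : n * D - p * t ^ 2 = 3) :
    ∃ x y z : ℤ, x ^ 2 + y ^ 2 + 3 * z ^ 2 = n := by
  obtain ⟨q, hq⟩ := hβ
  have hminor : p * q - β ^ 2 = D := by linarith
  obtain ⟨u₁, u₂, u₃, v₁, v₂, v₃, w₁, w₂, w₃, hT | hT⟩ :=
    IsPulledBack.of_det_eq_three _ _ p q n t 0 β rfl rfl hp (by rwa [hminor])
      (by linear_combination h + n * hminor)
  · exact ⟨u₃, v₃, w₃, by linear_combination -hT 0 0 1⟩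
  · exfalso
    have hx := hT 1 0 0
    have hy := hT 0 1 0
    have hxy := hT 1 1 0
    have hp' : p = u₁ ^ 2 + 2 * (v₁ ^ 2 + v₁ * w₁ + w₁ ^ 2) := by linear_combination hx
    have hq' : q = u₂ ^ 2 + 2 * (v₂ ^ 2 + v₂ * w₂ + w₂ ^ 2) := by linear_combination hy
    have hβ' : β = u₁ * u₂ + 2 * v₁ * v₂ + v₁ * w₂ + v₂ * w₁ + 2 * w₁ * w₂ := by linarith
    have hsq : D + (u₁ * (v₂ - w₂) - u₂ * (v₁ - w₁)) ^ 2 =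
        3 * (u₁ ^ 2 * (v₂ ^ 2 + w₂ ^ 2) + u₂ ^ 2 * (v₁ ^ 2 + w₁ ^ 2)
          - 2 * u₁ * u₂ * (v₁ * v₂ + w₁ * w₂) + (v₁ * w₂ - v₂ * w₁) ^ 2) := by
      rw [← hminor, hp', hq', hβ']
      ring
    generalize u₁ * (v₂ - w₂) - u₂ * (v₁ - w₁) = s at hsq
    have hs : s ^ 2 % 3 = 0 ∨ s ^ 2 % 3 = 1 := by
      have : s % 3 = 0 ∨ s % 3 = 1 ∨ s % 3 = 2 := by omega
      rcases this with h | h | h <;> simp [pow_two, Int.mul_emod, h]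
    omega

theorem jacobiSym_neg_three {m : ℕ} (h2 : m % 2 = 1) (h3 : m % 3 = 1) : jacobiSym (-3) m = 1 := by
  have hm : Odd m := Nat.odd_iff.mpr h2
  have hmod : jacobiSym m 3 = 1 := by
    rw [jacobiSym.mod_left, show ((m : ℤ) % (3 : ℕ)) = 1 by omega, jacobiSym.one_left]
  rw [jacobiSym.neg _ hm]
  obtain h4 | h4 : m % 4 = 1 ∨ m % 4 = 3 := by omega
  · have := jacobiSym.quadratic_reciprocity_one_mod_four h4 (b := 3) (by decide)
    rw [ZMod.χ₄_nat_one_mod_four h4, one_mul, ← hmod, this]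
    rfl
  · have := jacobiSym.quadratic_reciprocity_three_mod_four h4 (b := 3) (by decide)
    rw [hmod] at this
    rw [ZMod.χ₄_nat_three_mod_four h4, neg_one_mul]
    exact this.symm

theorem exists_dvd_sq_add_four_mul {p m : ℕ} (hp : p.Prime) (hp4 : p % 4 = 1) (hm : m % 2 = 1)
    (hJ : jacobiSym p m = 1) : ∃ β : ℤ, (p : ℤ) ∣ β ^ 2 + 4 * m := by
  have := Fact.mk hp
  have h1 : legendreSym p m = 1 := by
    rw [jacobiSym.legendreSym.to_jacobiSym, ← hJ]
    exact (jacobiSym.quadratic_reciprocity_one_mod_four hp4 (Nat.odd_iff.mpr hm)).symm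
  have h0 : ((m : ℤ) : ZMod p) ≠ 0 := fun h => by
    rw [(legendreSym.eq_zero_iff p m).mpr h] at h1
    exact absurd h1 (by norm_num)
  obtain ⟨r, hr⟩ := (legendreSym.eq_one_iff p h0).mp h1
  obtain ⟨i, hi⟩ := (ZMod.exists_sq_eq_neg_one_iff (p := p)).mpr (by omega)
  obtain ⟨β, hβ⟩ := ZMod.intCast_surjective (2 * r * i)
  refine ⟨β, (ZMod.intCast_zmod_eq_zero_iff_dvd _ p).mp ?_⟩
  push_cast at hr ⊢
  rw [hβ]
  linear_combination -4 * r ^ 2 * hi + 4 * hr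

theorem exists_prime_eq_mul_add {q r : ℕ} (hq : q ≠ 0) (h : IsCoprime (r : ℤ) q) :
    ∃ p k : ℕ, p.Prime ∧ p = q * k + r := by
  obtain ⟨p, hpr, hp, hmod⟩ := Nat.forall_exists_prime_gt_and_modEq r hq
    (Nat.isCoprime_iff_coprime.mp h)
  obtain ⟨k, hk⟩ := (Nat.modEq_iff_dvd' hpr.le).mp hmod.symm
  exact ⟨p, k, hp, by omega⟩

theorem exists_rep_of_not_three_dvd {n : ℕ} (hn : 0 < n) (h3 : n % 3 ≠ 0) :
    ∃ x y z : ℤ, x ^ 2 + y ^ 2 + 3 * z ^ 2 = (n : ℤ) := by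
  have hcop : IsCoprime ((4 * n - 3 : ℕ) : ℤ) ((24 * n : ℕ) : ℤ) := by
    rw [Nat.isCoprime_iff_coprime]
    refine Nat.Coprime.mul_right ?_ ?_
    · refine Nat.Coprime.mul_right (k := 4 * n - 3) (m := 8) (n := 3) ?_ ?_
      · exact Nat.Coprime.pow_right 3 (Nat.coprime_two_right.mpr (Nat.odd_iff.mpr (by omega)))
      · exact ((Nat.Prime.coprime_iff_not_dvd Nat.prime_three).mpr (by omega)).symm
    · rw [← Nat.isCoprime_iff_coprime]
      have h : IsCoprime (3 : ℤ) n := by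
        exact_mod_cast Nat.isCoprime_iff_coprime.mpr
          ((Nat.Prime.coprime_iff_not_dvd Nat.prime_three).mpr (by omega))
      obtain ⟨s, t, hst⟩ := h
      refine ⟨-s, t + 4 * s, ?_⟩
      rw [Nat.cast_sub (by omega)]
      push_cast
      linear_combination hst
  obtain ⟨p, k, hp, hpk⟩ := exists_prime_eq_mul_add (by omega) hcop
  have hpk' : (p : ℤ) = 4 * n * ((6 * k + 1 : ℕ) : ℤ) - 3 := by
    rw [hpk]; push_cast [Nat.cast_sub (show 3 ≤ 4 * n by omega)]; ring
  have hp4 : p % 4 = 1 := by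
    have : (p : ℤ) = 4 * (n * ((6 * k + 1 : ℕ) : ℤ)) - 3 := by rw [hpk']; ring
    omega
  obtain ⟨β, hβ⟩ := exists_dvd_sq_add_four_mul hp hp4 (m := 6 * k + 1) (by omega) (by
    rw [← jacobiSym_neg_three (m := 6 * k + 1) (by omega) (by omega)]
    apply jacobiSym.mod_left'
    rw [hpk', show (4 * n * ((6 * k + 1 : ℕ) : ℤ) - 3) = -3 + ((6 * k + 1 : ℕ) : ℤ) * (4 * n) by ring,
      Int.add_mul_emod_self_left])
  exact exists_sq_add_sq_add_three_mul_sq (t := 1) (by exact_mod_cast hp.pos)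
    (by omega) (by omega) hβ (by linear_combination -hpk')

theorem exists_rep_three_mul {m : ℕ} (h3 : m % 3 = 1) :
    ∃ x y z : ℤ, x ^ 2 + y ^ 2 + 3 * z ^ 2 = ((3 * m : ℕ) : ℤ) := by
  obtain ⟨r, hr⟩ : ∃ r, 3 * r + 1 = 4 * m := ⟨(4 * m - 1) / 3, by omega⟩
  have hcop : IsCoprime (r : ℤ) ((8 * m : ℕ) : ℤ) := by
    rw [Nat.isCoprime_iff_coprime]
    refine Nat.Coprime.mul_right ?_ ?_
    · exact Nat.Coprime.pow_right 3 (Nat.coprime_two_right.mpr (Nat.odd_iff.mpr (by omega)))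
    · rw [← Nat.isCoprime_iff_coprime]
      exact ⟨-3, 4, by have : (3 * r + 1 : ℤ) = 4 * m := by exact_mod_cast hr
                       linear_combination -this⟩
  obtain ⟨p, k, hp, hpk⟩ := exists_prime_eq_mul_add (by omega) hcop
  have hpk' : 3 * (p : ℤ) = 4 * m * ((6 * k + 1 : ℕ) : ℤ) - 1 := by
    have : (3 * r + 1 : ℤ) = 4 * m := by exact_mod_cast hr
    rw [hpk]; push_cast; linear_combination this
  have hp4 : p % 4 = 1 := by
    have : 3 * (p : ℤ) = 4 * (m * ((6 * k + 1 : ℕ) : ℤ)) - 1 := by rw [hpk']; ring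
    omega
  obtain ⟨β, hβ⟩ := exists_dvd_sq_add_four_mul hp hp4 (m := 6 * k + 1) (by omega) (by
    have hneg := jacobiSym_neg_three (m := 6 * k + 1) (by omega) (by omega)
    have hmul : jacobiSym (-3 * p) (6 * k + 1) = 1 := by
      rw [← jacobiSym.one_left (6 * k + 1)]
      apply jacobiSym.mod_left'
      rw [show (-3 * p : ℤ) = 1 + ((6 * k + 1 : ℕ) : ℤ) * (-4 * m) by linear_combination -hpk',
        Int.add_mul_emod_self_left]
    rwa [jacobiSym.mul_left, hneg, one_mul] at hmul)
  exact exists_sq_add_sq_add_three_mul_sq (t := 3) (by exact_mod_cast hp.pos)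
    (by omega) (by omega) hβ (by push_cast at hpk' ⊢; linear_combination -3 * hpk')

theorem exists_rep_of_not_exceptional (n : ℕ) (hn : 0 < n)
    (h : ¬ ∃ d u : ℕ, Odd d ∧ u % 3 = 2 ∧ n = 3 ^ d * u) :
    ∃ x y z : ℤ, x ^ 2 + y ^ 2 + 3 * z ^ 2 = (n : ℤ) := by
  induction n using Nat.strong_induction_on with
  | _ n ih =>
  by_cases h3 : n % 3 = 0
  · obtain ⟨m, rfl⟩ := Nat.dvd_of_mod_eq_zero h3
    obtain hm | hm | hm : m % 3 = 0 ∨ m % 3 = 1 ∨ m % 3 = 2 := by omega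
    · obtain ⟨l, rfl⟩ := Nat.dvd_of_mod_eq_zero hm
      obtain ⟨x, y, z, hxyz⟩ := ih l (by omega) (by omega) (by
        rintro ⟨d, u, hd, hu, rfl⟩
        exact h ⟨d + 2, u, hd.add_even even_two, hu, by ring⟩)
      exact ⟨3 * x, 3 * y, 3 * z, by push_cast; linear_combination 9 * hxyz⟩
    · exact exists_rep_three_mul hm
    · exact absurd ⟨1, m, odd_one, hm, by ring⟩ h
  · exact exists_rep_of_not_three_dvd hn h3

theorem three_dvd_of_three_dvd_sq_add_sq {x y : ℤ} (h : 3 ∣ x ^ 2 + y ^ 2) : 3 ∣ x ∧ 3 ∣ y := by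
  have hx : x % 3 = 0 ∨ x % 3 = 1 ∨ x % 3 = 2 := by omega
  have hy : y % 3 = 0 ∨ y % 3 = 1 ∨ y % 3 = 2 := by omega
  have h' := Int.emod_eq_zero_of_dvd h
  rcases hx with hx | hx | hx <;> rcases hy with hy | hy | hy <;>
    simp [pow_two, Int.add_emod, Int.mul_emod, hx, hy] at h'
  omega

theorem sq_add_sq_add_three_mul_sq_ne (k : ℕ) {u : ℕ} (hu : u % 3 = 2) (x y z : ℤ) :
    x ^ 2 + y ^ 2 + 3 * z ^ 2 ≠ 3 ^ (2 * k + 1) * u := by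
  induction k generalizing x y z with
  | zero =>
    intro h
    obtain ⟨⟨x, rfl⟩, ⟨y, rfl⟩⟩ := three_dvd_of_three_dvd_sq_add_sq (x := x) (y := y)
      ⟨u - z ^ 2, by linear_combination h⟩
    rw [mul_zero, zero_add, pow_one] at h
    have hz : z ^ 2 = u - 3 * (x ^ 2 + y ^ 2) := by linarith
    have hs : z ^ 2 % 3 = 0 ∨ z ^ 2 % 3 = 1 := by
      have : z % 3 = 0 ∨ z % 3 = 1 ∨ z % 3 = 2 := by omega
      rcases this with h | h | h <;> simp [pow_two, Int.mul_emod, h]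
    omega
  | succ k ih =>
    intro h
    obtain ⟨⟨x, rfl⟩, ⟨y, rfl⟩⟩ := three_dvd_of_three_dvd_sq_add_sq (x := x) (y := y)
      ⟨3 ^ (2 * k + 2) * u - z ^ 2, by linear_combination h⟩
    obtain ⟨z, rfl⟩ : 3 ∣ z := Int.prime_three.dvd_of_dvd_pow (n := 2)
      ⟨3 ^ (2 * k + 1) * u - (x ^ 2 + y ^ 2), by
        have : 3 * z ^ 2 = 3 * (3 * (3 ^ (2 * k + 1) * u - (x ^ 2 + y ^ 2))) := by
          linear_combination h
        linarith⟩
    refine ih x y z ?_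
    have : 9 * (x ^ 2 + y ^ 2 + 3 * z ^ 2) = 9 * (3 ^ (2 * k + 1) * (u : ℤ)) := by
      linear_combination h
    linarith

theorem stmt_8 (n : ℕ) (hn : 0 < n) :
    (¬ ∃ x y z : ℤ, x ^ 2 + y ^ 2 + 3 * z ^ 2 = (n : ℤ)) ↔
      ∃ d u : ℕ, Odd d ∧ u % 3 = 2 ∧ n = 3 ^ d * u := by
  constructor
  · intro h
    by_contra hne
    exact h (exists_rep_of_not_exceptional n hn hne)
  · rintro ⟨d, u, ⟨k, rfl⟩, hu, rfl⟩ ⟨x, y, z, h⟩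
    exact sq_add_sq_add_three_mul_sq_ne k hu x y z (by exact_mod_cast h)
end
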